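/- Let (W,S) be a finitely generated Coxeter system acting geometrically on a proper CAT(0) space X, let x ∈ X be a point fixed by no nontrivial element of W, and let Λ_x be the copy of the Cayley graph Λ(W,S) at x with W-equivariant map P_x : Λ(W,S) → Λ_x. Then there is a constant K such that every CAT(0) geodesic ray in X issuing from x is K-tracked by the image under P_x of some geodesic edge path ray in Λ(W,S), i.e., every point of the ray is within distance K of P_x(β) for some Cayley graph geodesic β. -/

import Mathlib

/-!
Common definitions: Cayley graph of a Coxeter system, walls, sides,
bracket numbers, edge paths, quasi-geodesics, tracking.
-/

namespace CoxTrack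

variable {B : Type*} {W : Type*} [Group W] {M : CoxeterMatrix B}

/-- The word metric on the Cayley graph `Λ(W,S)`: `d u v = ℓ(u⁻¹ v)`. -/
noncomputable def d (cs : CoxeterSystem M W) (u v : W) : ℕ := cs.length (u⁻¹ * v)

/-- `u` and `v` are adjacent vertices (endpoints of a common edge) of `Λ(W,S)`. -/
def Adj (cs : CoxeterSystem M W) (u v : W) : Prop := ∃ i : B, v = u * cs.simple i

/-- The edge with endpoints `u` and `v` belongs to the wall of the reflection `t`
(i.e. `t` fixes this edge setwise, interchanging its endpoints). -/
def EdgeInWall (cs : CoxeterSystem M W) (t u v : W) : Prop :=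
  Adj cs u v ∧ t * u = v

/-- `v` is a vertex of `Q̄`, the union of the edges of the wall of the reflection `t`. -/
def InWallBar (cs : CoxeterSystem M W) (t v : W) : Prop :=
  ∃ i : B, t * v = v * cs.simple i

/-- Vertices `u` and `v` lie on the same side of the wall of the reflection `t`. -/
def SameSide (cs : CoxeterSystem M W) (t u v : W) : Prop :=
  (cs.length (t * u) < cs.length u ↔ cs.length (t * v) < cs.length v)

/-- The wall of the reflection `t` separates the vertices `u` and `v`. -/
def SeparatesPts (cs : CoxeterSystem M W) (t u v : W) : Prop := ¬ SameSide cs t u v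

/-- The walls of the reflections `t` and `t'` are parallel: they are distinct and
all edges of each one lie on one side of the other. -/
def Parallel (cs : CoxeterSystem M W) (t t' : W) : Prop :=
  t ≠ t' ∧ (∀ u v, InWallBar cs t' u → InWallBar cs t' v → SameSide cs t u v)
         ∧ (∀ u v, InWallBar cs t u → InWallBar cs t v → SameSide cs t' u v)

/-- The walls of the reflections `t` and `t'` cross (they are distinct and not parallel). -/
def Crosses (cs : CoxeterSystem M W) (t t' : W) : Prop := t ≠ t' ∧ ¬ Parallel cs t t'

/-- The wall of the reflection `r` separates `Q̄` (for the wall of the reflection `t`)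
from the vertex `p`. -/
def SepWallFromPt (cs : CoxeterSystem M W) (r t p : W) : Prop :=
  ∀ v, InWallBar cs t v → SeparatesPts cs r v p

/-- The distance from the vertex `p` to `Q̄` (the wall of the reflection `t`),
measured to the nearest vertex of `Q̄`. -/
noncomputable def wallDist (cs : CoxeterSystem M W) (t p : W) : ℕ :=
  sInf {n : ℕ | ∃ v, InWallBar cs t v ∧ d cs p v = n}

/-- `v 0, v 1, …, v n` are the consecutive vertices of an edge path of length `n` in `Λ(W,S)`. -/
def IsPath (cs : CoxeterSystem M W) (v : ℕ → W) (n : ℕ) : Prop :=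
  ∀ k, k < n → Adj cs (v k) (v (k+1))

/-- `v 0, …, v n` are the consecutive vertices of a geodesic edge path of length `n`. -/
def IsGeodesic (cs : CoxeterSystem M W) (v : ℕ → W) (n : ℕ) : Prop :=
  IsPath cs v n ∧ d cs (v 0) (v n) = n

/-- `v 0, v 1, …` are the consecutive vertices of an edge path ray. -/
def IsRay (cs : CoxeterSystem M W) (v : ℕ → W) : Prop := ∀ k, Adj cs (v k) (v (k+1))

/-- A geodesic edge path ray. -/
def IsGeodesicRay (cs : CoxeterSystem M W) (v : ℕ → W) : Prop :=
  IsRay cs v ∧ ∀ j k, j ≤ k → d cs (v j) (v k) = k - j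

/-- `…, v (-1), v 0, v 1, …` are the consecutive vertices of an edge path line. -/
def IsLine (cs : CoxeterSystem M W) (v : ℤ → W) : Prop := ∀ k : ℤ, Adj cs (v k) (v (k+1))

/-- A geodesic edge path line. -/
def IsGeodesicLine (cs : CoxeterSystem M W) (v : ℤ → W) : Prop :=
  IsLine cs v ∧ ∀ j k : ℤ, j ≤ k → (d cs (v j) (v k) : ℤ) = k - j

/-- The set of (reflections of) walls bracketing the vertex `v k` of the edge path
`v 0, …, v n`: walls containing an edge of the path before `v k` and an edge after `v k`. -/
def Brackets (cs : CoxeterSystem M W) (v : ℕ → W) (n k : ℕ) : Set W :=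
  {t | ∃ j m, j < k ∧ k ≤ m ∧ m < n ∧
      EdgeInWall cs t (v j) (v (j+1)) ∧ EdgeInWall cs t (v m) (v (m+1))}

/-- The set of walls bracketing the vertex `v k` of the edge path ray `v`. -/
def BracketsRay (cs : CoxeterSystem M W) (v : ℕ → W) (k : ℕ) : Set W :=
  {t | ∃ j m, j < k ∧ k ≤ m ∧
      EdgeInWall cs t (v j) (v (j+1)) ∧ EdgeInWall cs t (v m) (v (m+1))}

/-- The set of walls bracketing the vertex `v k` of the edge path line `v`. -/
def BracketsLine (cs : CoxeterSystem M W) (v : ℤ → W) (k : ℤ) : Set W :=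
  {t | ∃ j m : ℤ, j < k ∧ k ≤ m ∧
      EdgeInWall cs t (v j) (v (j+1)) ∧ EdgeInWall cs t (v m) (v (m+1))}

/-- The edge path `v 0, …, v n` is a `(lam, eps)`-quasi-geodesic. -/
def IsQG (cs : CoxeterSystem M W) (lam eps : ℝ) (v : ℕ → W) (n : ℕ) : Prop :=
  IsPath cs v n ∧ ∀ j k, j ≤ n → k ≤ n →
    |(j : ℝ) - (k : ℝ)| ≤ lam * (d cs (v j) (v k) : ℝ) + eps

/-- The edge path ray `v` is a `(lam, eps)`-quasi-geodesic. -/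
def IsQGRay (cs : CoxeterSystem M W) (lam eps : ℝ) (v : ℕ → W) : Prop :=
  IsRay cs v ∧ ∀ j k : ℕ, |(j : ℝ) - (k : ℝ)| ≤ lam * (d cs (v j) (v k) : ℝ) + eps

/-- The edge path line `v` is a `(lam, eps)`-quasi-geodesic. -/
def IsQGLine (cs : CoxeterSystem M W) (lam eps : ℝ) (v : ℤ → W) : Prop :=
  IsLine cs v ∧ ∀ j k : ℤ, |(j : ℝ) - (k : ℝ)| ≤ lam * (d cs (v j) (v k) : ℝ) + eps

/-- `P` is a Parallel Wall function for `(W,S)`: for each positive integer `n`, every wall `Q`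
and every vertex `p` at distance at least `P n` from `Q̄`, there are `n` distinct pairwise
parallel walls separating `Q̄` from `p`. -/
def IsParallelWallFn (cs : CoxeterSystem M W) (P : ℕ → ℕ) : Prop :=
  ∀ n : ℕ, 0 < n → ∀ t p : W, cs.IsReflection t → P n ≤ wallDist cs t p →
    ∃ T : Finset W, T.card = n ∧ (∀ r ∈ T, cs.IsReflection r) ∧
      (∀ r ∈ T, ∀ r' ∈ T, r ≠ r' → Parallel cs r r') ∧
      (∀ r ∈ T, SepWallFromPt cs r t p)

/-- `w 0, …, w m` (with distinguished approximation vertices `w (c 0), …, w (c n)`)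
is an `L`-approximation of the edge path `v 0, …, v n`: it is an edge path with the
same endpoints, the segment from `w (c i)` to `w (c (i+1))` is geodesic, and the
approximation vertex `w (c i)` is within `L` of `v i`. -/
def IsApprox (cs : CoxeterSystem M W) (L : ℕ) (v : ℕ → W) (n : ℕ)
    (w : ℕ → W) (m : ℕ) (c : ℕ → ℕ) : Prop :=
  IsPath cs w m ∧ c 0 = 0 ∧ c n = m ∧ (∀ i, i < n → c i ≤ c (i+1)) ∧
  w 0 = v 0 ∧ w m = v n ∧
  (∀ i, i ≤ n → d cs (w (c i)) (v i) ≤ L) ∧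
  (∀ i, i < n → d cs (w (c i)) (w (c (i+1))) = c (i+1) - c i)

open Pointwise

/-- A proper metric space is CAT(0) if it has midpoints and satisfies the CN inequality
of Bruhat and Tits (equivalent to the comparison-triangle definition for complete
geodesic spaces). -/
def IsCAT0 (X : Type*) [MetricSpace X] : Prop :=
  (∀ x y : X, ∃ m : X, dist x m = dist x y / 2 ∧ dist m y = dist x y / 2) ∧
  (∀ x y z m : X, dist y m = dist y z / 2 → dist m z = dist y z / 2 →
    dist x m ^ 2 ≤ (dist x y ^ 2 + dist x z ^ 2) / 2 - dist y z ^ 2 / 4)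

section Inversions

/-- The set of left inversions of `w`: the reflections whose walls separate `1` from `w`. -/
def inversions (cs : CoxeterSystem M W) (w : W) : Set W := {t | cs.IsLeftInversion w t}

open Classical in
/-- The action of a simple reflection `s` on `W × ZMod 2`: conjugation by `s` on the first
coordinate, flipping the sign exactly over `s`. -/
noncomputable def signedConj (s : W) : Function.End (W × ZMod 2) :=
  fun p => (s * p.1 * s, p.2 + if p.1 = s then 1 else 0)

open Classical in
theorem signedConj_mul_pow_apply {a b : W} (ha : a * a = 1) (hb : b * b = 1) (n : ℕ)
    (p : W × ZMod 2) :
    ((signedConj a * signedConj b) ^ n : Function.End (W × ZMod 2)) p =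
      ((a * b) ^ n * p.1 * ((a * b) ^ n)⁻¹,
        p.2 + ∑ l ∈ Finset.range (2 * n), if p.1 = b * (a * b) ^ l then 1 else 0) := by
  have ha' : a⁻¹ = a := inv_eq_of_mul_eq_one_left ha
  have hb' : b⁻¹ = b := inv_eq_of_mul_eq_one_left hb
  have hconj : ∀ k : ℕ, b * (a * b) ^ k = ((a * b) ^ k)⁻¹ * b := by
    intro k
    induction k with
    | zero => simp
    | succ k ih => rw [pow_succ, ← mul_assoc, ih, ← pow_succ, pow_succ']; simp [mul_assoc, ha', hb']
  have hconj' : ∀ c q : W, b * (c * q * c⁻¹) * b = a ↔ q = c⁻¹ * (b * a * b) * c := by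
    have hbb : ∀ q : W, b * (b * q) = q := fun q => by rw [← mul_assoc, hb, one_mul]
    intro c q
    constructor
    · intro h
      rw [← h]
      simp [mul_assoc, hbb]
    · rintro rfl
      simp [mul_assoc, hbb, hb]
  induction n with
  | zero => simp [show (1 : Function.End (W × ZMod 2)) p = p from rfl]
  | succ n ih =>
    rw [pow_succ', show ((signedConj a * signedConj b) *
      (signedConj a * signedConj b) ^ n : Function.End (W × ZMod 2)) p =
      signedConj a (signedConj b (((signedConj a * signedConj b) ^ n :
        Function.End (W × ZMod 2)) p)) from rfl, ih]
    have h1 : (a * b) ^ n * p.1 * ((a * b) ^ n)⁻¹ = b ↔ p.1 = b * (a * b) ^ (2 * n) := by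
      rw [two_mul, pow_add, ← mul_assoc, hconj, mul_inv_eq_iff_eq_mul, mul_assoc,
        eq_inv_mul_iff_mul_eq]
    have h2 : b * ((a * b) ^ n * p.1 * ((a * b) ^ n)⁻¹) * b = a ↔
        p.1 = b * (a * b) ^ (2 * n + 1) := by
      have hpow : b * (a * b) ^ (2 * n + 1) = ((a * b) ^ n)⁻¹ * (b * a * b) * (a * b) ^ n := by
        rw [show 2 * n + 1 = n + 1 + n by ring, pow_add, pow_succ, ← mul_assoc, ← mul_assoc, hconj]
        simp only [mul_assoc]
      rw [hpow]
      exact hconj' _ _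
    simp only [signedConj, h1, h2, Prod.mk.injEq]
    refine ⟨by rw [pow_succ']; simp [mul_assoc, ha', hb'], ?_⟩
    rw [show 2 * (n + 1) = 2 * n + 1 + 1 by ring, Finset.sum_range_succ, Finset.sum_range_succ]
    ring

theorem isLiftable_signedConj (cs : CoxeterSystem M W) :
    M.IsLiftable fun i => signedConj (cs.simple i) := by
  classical
  intro i j
  funext p
  rw [signedConj_mul_pow_apply (by simp) (by simp), cs.simple_mul_simple_pow, two_mul,
    Finset.sum_range_add]
  simp only [pow_add, cs.simple_mul_simple_pow, one_mul, CharTwo.add_self_eq_zero]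
  simp
  rfl

/-- The action of `W` on `W × ZMod 2` extending `signedConj`. -/
noncomputable def signedConjHom (cs : CoxeterSystem M W) : W →* Function.End (W × ZMod 2) :=
  cs.lift ⟨_, isLiftable_signedConj cs⟩

theorem signedConjHom_apply (cs : CoxeterSystem M W) (w : W) (p : W × ZMod 2) :
    signedConjHom cs w p = (w * p.1 * w⁻¹, p.2 + (signedConjHom cs w (p.1, 0)).2) := by
  induction w using cs.simple_induction_left generalizing p with
  | one =>
    rw [map_one, show ∀ q, (1 : Function.End (W × ZMod 2)) q = q from fun _ => rfl]
    simp [show ∀ q, (1 : Function.End (W × ZMod 2)) q = q from fun _ => rfl]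
  | mul_simple_left w i ih =>
    rw [map_mul]
    simp only [show ∀ q, (signedConjHom cs (cs.simple i) * signedConjHom cs w) q =
      signedConjHom cs (cs.simple i) (signedConjHom cs w q) from fun _ => rfl]
    rw [ih, signedConjHom, cs.lift_apply_simple]
    simp only [signedConj, mul_inv_rev, CoxeterSystem.inv_simple, Prod.mk.injEq]
    refine ⟨by simp only [mul_assoc], ?_⟩
    rw [← signedConjHom, ih (p.1, 0)]
    ring

/-- The parity of the number of times a path from `1` to `w` crosses the wall of `t`. -/
noncomputable def crossParity (cs : CoxeterSystem M W) (w t : W) : ZMod 2 :=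
  (signedConjHom cs w⁻¹ (t, 0)).2

theorem crossParity_mul (cs : CoxeterSystem M W) (a b t : W) :
    crossParity cs (a * b) t = crossParity cs a t + crossParity cs b (a⁻¹ * t * a) := by
  unfold crossParity
  rw [mul_inv_rev, map_mul, show (signedConjHom cs b⁻¹ * signedConjHom cs a⁻¹) (t, 0) =
      signedConjHom cs b⁻¹ (signedConjHom cs a⁻¹ (t, 0)) from rfl,
    signedConjHom_apply cs a⁻¹, signedConjHom_apply cs b⁻¹]
  simp

theorem crossParity_one (cs : CoxeterSystem M W) (t : W) : crossParity cs 1 t = 0 := by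
  simp [crossParity]; rfl

open Classical in
theorem crossParity_simple (cs : CoxeterSystem M W) (i : B) (t : W) :
    crossParity cs (cs.simple i) t = if t = cs.simple i then 1 else 0 := by
  simp [crossParity, signedConjHom, cs.lift_apply_simple, signedConj]

theorem crossParity_self (cs : CoxeterSystem M W) {t : W} (ht : cs.IsReflection t) :
    crossParity cs t t = 1 := by
  obtain ⟨w, i, rfl⟩ := ht
  have h := crossParity_mul cs w w⁻¹ (w * cs.simple i * w⁻¹)
  rw [mul_inv_cancel, crossParity_one] at h
  rw [mul_assoc, crossParity_mul, crossParity_mul]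
  simp only [mul_assoc, inv_mul_cancel_left, inv_mul_cancel, mul_one, CoxeterSystem.inv_simple,
    CoxeterSystem.simple_mul_simple_self, one_mul, crossParity_simple, if_true] at h ⊢
  linear_combination -h

theorem mem_leftInvSeq_of_crossParity (cs : CoxeterSystem M W) (ω : List B) {t : W}
    (h : crossParity cs (cs.wordProd ω) t ≠ 0) : t ∈ cs.leftInvSeq ω := by
  induction ω generalizing t with
  | nil => simp [crossParity_one] at h
  | cons i ω ih =>
    rw [cs.wordProd_cons, crossParity_mul, crossParity_simple] at h
    rw [CoxeterSystem.leftInvSeq, List.mem_cons]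
    by_cases hti : t = cs.simple i
    · exact Or.inl hti
    · rw [if_neg hti, zero_add] at h
      refine Or.inr (List.mem_map.2 ⟨_, ih h, ?_⟩)
      simp [mul_assoc]

theorem mem_inversions_iff (cs : CoxeterSystem M W) {w t : W} :
    t ∈ inversions cs w ↔ crossParity cs w t ≠ 0 := by
  have key : ∀ w, crossParity cs w t ≠ 0 → cs.IsLeftInversion w t := by
    intro w h
    obtain ⟨ω, hω, rfl⟩ := cs.exists_isReduced w
    exact cs.isLeftInversion_of_mem_leftInvSeq hω (mem_leftInvSeq_of_crossParity cs ω h)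
  refine ⟨fun ⟨hr, hl⟩ h0 => ?_, key w⟩
  have := (key (t * w) (by
    rw [crossParity_mul, crossParity_self cs hr, inv_mul_cancel, one_mul, h0]; simp)).2
  rw [← mul_assoc, hr.mul_self, one_mul] at this
  omega

theorem mem_inversions_mul (cs : CoxeterSystem M W) {a b t : W} :
    t ∈ inversions cs (a * b) ↔ ¬(t ∈ inversions cs a ↔ a⁻¹ * t * a ∈ inversions cs b) := by
  simp only [mem_inversions_iff, crossParity_mul]
  generalize crossParity cs a t = p
  generalize crossParity cs b (a⁻¹ * t * a) = q
  revert p q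
  decide

theorem inversions_wordProd (cs : CoxeterSystem M W) {ω : List B} (hω : cs.IsReduced ω) :
    inversions cs (cs.wordProd ω) = {t | t ∈ cs.leftInvSeq ω} := by
  ext t
  exact ⟨fun h => mem_leftInvSeq_of_crossParity cs ω ((mem_inversions_iff cs).1 h),
    fun h => cs.isLeftInversion_of_mem_leftInvSeq hω h⟩

theorem finite_inversions (cs : CoxeterSystem M W) (w : W) : (inversions cs w).Finite := by
  obtain ⟨ω, hω, rfl⟩ := cs.exists_isReduced w
  rw [inversions_wordProd cs hω]
  exact List.finite_toSet _

theorem ncard_inversions (cs : CoxeterSystem M W) (w : W) :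
    (inversions cs w).ncard = cs.length w := by
  classical
  obtain ⟨ω, hω, rfl⟩ := cs.exists_isReduced w
  rw [inversions_wordProd cs hω, ← List.coe_toFinset, Set.ncard_coe_finset,
    List.toFinset_card_of_nodup hω.nodup_leftInvSeq, cs.length_leftInvSeq, hω.eq]

theorem inversions_one (cs : CoxeterSystem M W) : inversions cs 1 = ∅ := by
  ext t; simp [mem_inversions_iff, crossParity_one]

theorem mem_inversions_simple (cs : CoxeterSystem M W) {i : B} {t : W} :
    t ∈ inversions cs (cs.simple i) ↔ t = cs.simple i := by
  classical
  simp [mem_inversions_iff, crossParity_simple]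

theorem mem_inversions_simple_mul (cs : CoxeterSystem M W) {i : B} {w t : W} :
    t ∈ inversions cs (cs.simple i * w) ↔
      ¬(t = cs.simple i ↔ cs.simple i * t * cs.simple i ∈ inversions cs w) := by
  rw [mem_inversions_mul, mem_inversions_simple, CoxeterSystem.inv_simple]

theorem simple_mem_inversions_simple_mul (cs : CoxeterSystem M W) {i : B} {w : W} :
    cs.simple i ∈ inversions cs (cs.simple i * w) ↔ cs.simple i ∉ inversions cs w := by
  simp [mem_inversions_simple_mul]

theorem length_mono (cs : CoxeterSystem M W) {u w : W} (h : inversions cs u ⊆ inversions cs w) :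
    cs.length u ≤ cs.length w := by
  rw [← ncard_inversions, ← ncard_inversions]
  exact Set.ncard_le_ncard h (finite_inversions cs w)

theorem length_add_length_inv_mul (cs : CoxeterSystem M W) {u w : W}
    (h : inversions cs u ⊆ inversions cs w) :
    cs.length u + cs.length (u⁻¹ * w) = cs.length w := by
  have himg : inversions cs (u⁻¹ * w) =
      (MulAut.conj u⁻¹ : W → W) '' (inversions cs w \ inversions cs u) := by
    ext t
    have := mem_inversions_mul cs (a := u) (b := u⁻¹ * w) (t := u * t * u⁻¹)
    simp only [mul_inv_cancel_left, mul_assoc, inv_mul_cancel_left, inv_mul_cancel, mul_one] at this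
    constructor
    · intro ht
      refine ⟨u * t * u⁻¹, ⟨?_, ?_⟩, by simp [mul_assoc]⟩ <;>
      · have h' := @h (u * (t * u⁻¹))
        simp only [mul_assoc]
        tauto
    · rintro ⟨r, ⟨hr, hr'⟩, rfl⟩
      simp only [MulAut.conj_apply, mul_assoc, inv_inv, mul_inv_cancel_left, mul_inv_cancel,
        mul_one] at this ⊢
      tauto
  rw [← ncard_inversions cs (u⁻¹ * w), himg,
    Set.ncard_image_of_injective _ (MulAut.conj u⁻¹).injective,
    ← ncard_inversions, ← ncard_inversions, add_comm,
    Set.ncard_sdiff_add_ncard_of_subset h (finite_inversions cs w)]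

theorem inversions_subset_of_length_add_le (cs : CoxeterSystem M W) {u w : W}
    (h : cs.length u + cs.length (u⁻¹ * w) ≤ cs.length w) :
    inversions cs u ⊆ inversions cs w := by
  intro t ht
  by_contra hw
  have hmul := mem_inversions_mul cs (a := u) (b := u⁻¹ * w) (t := t)
  rw [mul_inv_cancel_left] at hmul
  have hb : u⁻¹ * t * u ∈ inversions cs (u⁻¹ * w) := by tauto
  have h1 := ht.2
  have h2 := hb.2
  have h3 := cs.length_mul_le (t * u) (u⁻¹ * t * u * (u⁻¹ * w))
  rw [show t * u * (u⁻¹ * t * u * (u⁻¹ * w)) = t * t * w by group, ht.1.mul_self, one_mul] at h3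
  omega

theorem eq_of_inversions_subset (cs : CoxeterSystem M W) {u w : W}
    (h : inversions cs u ⊆ inversions cs w) (hl : cs.length w ≤ cs.length u) : u = w := by
  have h1 := length_add_length_inv_mul cs h
  have h3 : cs.length (u⁻¹ * w) = 0 := by omega
  exact inv_mul_eq_one.1 (cs.length_eq_zero_iff.1 h3)

theorem length_simple_mul_of_notMem (cs : CoxeterSystem M W) {i : B} {w : W}
    (h : cs.simple i ∉ inversions cs w) : cs.length (cs.simple i * w) = cs.length w + 1 := by
  rcases cs.length_simple_mul w i with h' | h'
  · exact h'
  · exact absurd ⟨cs.isReflection_simple i, by omega⟩ h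

theorem length_simple_mul_of_mem (cs : CoxeterSystem M W) {i : B} {w : W}
    (h : cs.simple i ∈ inversions cs w) : cs.length (cs.simple i * w) + 1 = cs.length w := by
  have := h.2
  rcases cs.length_simple_mul w i with h' | h' <;> omega

/-- The exchange condition, in terms of the weak order. -/
theorem inversions_simple_mul_subset (cs : CoxeterSystem M W) {i : B} {a w : W}
    (h : inversions cs a ⊆ inversions cs w) (hw : cs.simple i ∈ inversions cs w)
    (ha : cs.simple i ∉ inversions cs a) :
    inversions cs (cs.simple i * a) ⊆ inversions cs w := by
  apply inversions_subset_of_length_add_le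
  have hmul := mem_inversions_mul cs (a := a) (b := a⁻¹ * w) (t := cs.simple i)
  rw [mul_inv_cancel_left] at hmul
  have hb : a⁻¹ * cs.simple i * a ∈ inversions cs (a⁻¹ * w) := by tauto
  have h2 := hb.2
  rw [show a⁻¹ * cs.simple i * a * (a⁻¹ * w) = a⁻¹ * cs.simple i * w by group] at h2
  have h1 := length_add_length_inv_mul cs h
  rw [length_simple_mul_of_notMem cs ha, mul_inv_rev, CoxeterSystem.inv_simple]
  omega

theorem inversions_simple_mul_subset_simple_mul (cs : CoxeterSystem M W) {i : B} {x y : W}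
    (h : inversions cs x ⊆ inversions cs y)
    (hxy : cs.simple i ∈ inversions cs y → cs.simple i ∈ inversions cs x) :
    inversions cs (cs.simple i * x) ⊆ inversions cs (cs.simple i * y) := by
  intro t ht
  have h' := @h (cs.simple i * t * cs.simple i)
  rw [mem_inversions_simple_mul] at ht ⊢
  by_cases hti : t = cs.simple i
  · subst hti
    simp only [CoxeterSystem.simple_mul_simple_self, one_mul, true_iff] at ht ⊢
    tauto
  · tauto

end Inversions

section WeakOrder

/-- `j` is the least upper bound of `x` and `y` for the weak order (inclusion of inversion
sets). -/
def IsJoin (cs : CoxeterSystem M W) (x y j : W) : Prop :=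
  inversions cs x ⊆ inversions cs j ∧ inversions cs y ⊆ inversions cs j ∧
    ∀ w, inversions cs x ⊆ inversions cs w → inversions cs y ⊆ inversions cs w →
      inversions cs j ⊆ inversions cs w

/-- The alternating product of `n` simple reflections, starting with that of `i`. -/
def altProd (cs : CoxeterSystem M W) : B → B → ℕ → W
  | _, _, 0 => 1
  | i, j, n + 1 => cs.simple i * altProd cs j i n

theorem altProd_subset (cs : CoxeterSystem M W) {w : W} (n : ℕ) :
    ∀ i j : B, cs.simple i ∈ inversions cs w → cs.simple j ∈ inversions cs w →
    (∀ k < n, ¬(cs.simple i ∈ inversions cs (altProd cs i j k) ∧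
      cs.simple j ∈ inversions cs (altProd cs i j k))) →
    (∀ k < n, ¬(cs.simple j ∈ inversions cs (altProd cs j i k) ∧
      cs.simple i ∈ inversions cs (altProd cs j i k))) →
    inversions cs (altProd cs i j n) ⊆ inversions cs w ∧ cs.length (altProd cs i j n) = n ∧
      (0 < n → cs.simple i ∈ inversions cs (altProd cs i j n)) := by
  induction n with
  | zero => intro i j _ _ _ _; simp [altProd, inversions_one]
  | succ n ih =>
    intro i j hi hj hij hji
    obtain ⟨h1, h2, h3⟩ := ih j i hj hi (fun k hk => hji k (by omega))
      (fun k hk => hij k (by omega))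
    have hnot : cs.simple i ∉ inversions cs (altProd cs j i n) := by
      intro h
      rcases Nat.eq_zero_or_pos n with rfl | hn
      · simp [altProd, inversions_one] at h
      · exact hji n (by omega) ⟨h3 hn, h⟩
    exact ⟨inversions_simple_mul_subset cs h1 hi hnot,
      by rw [altProd, length_simple_mul_of_notMem cs hnot, h2],
      fun _ => (simple_mem_inversions_simple_mul cs).2 hnot⟩

/-- Two simple reflections with a common upper bound in the weak order have a join. -/
theorem exists_join_simple (cs : CoxeterSystem M W) {i j : B} {w : W}
    (hi : cs.simple i ∈ inversions cs w) (hj : cs.simple j ∈ inversions cs w) :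
    ∃ δ, cs.simple i ∈ inversions cs δ ∧ cs.simple j ∈ inversions cs δ ∧
      ∀ w', cs.simple i ∈ inversions cs w' → cs.simple j ∈ inversions cs w' →
        inversions cs δ ⊆ inversions cs w' := by
  classical
  set p : ℕ → Prop := fun k =>
    (cs.simple i ∈ inversions cs (altProd cs i j k) ∧
      cs.simple j ∈ inversions cs (altProd cs i j k)) ∨
    (cs.simple j ∈ inversions cs (altProd cs j i k) ∧
      cs.simple i ∈ inversions cs (altProd cs j i k)) with hp
  have hex : ∃ k, p k := by
    by_contra! hno
    simp only [hp, not_or] at hno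
    obtain ⟨h1, h2, -⟩ := altProd_subset cs (cs.length w + 1) i j hi hj
      (fun k _ => (hno k).1) (fun k _ => (hno k).2)
    have := length_mono cs h1
    omega
  have hmin : ∀ k < Nat.find hex, ¬p k := fun k hk => Nat.find_min hex hk
  simp only [hp, not_or] at hmin
  rcases Nat.find_spec hex with h | h
  · exact ⟨_, h.1, h.2, fun w' h1 h2 => (altProd_subset cs _ i j h1 h2
      (fun k hk => (hmin k hk).1) (fun k hk => (hmin k hk).2)).1⟩
  · exact ⟨_, h.2, h.1, fun w' h1 h2 => (altProd_subset cs _ j i h2 h1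
      (fun k hk => (hmin k hk).2) (fun k hk => (hmin k hk).1)).1⟩

/-- Elements with a common upper bound in the weak order have a join. -/
theorem exists_isJoin (cs : CoxeterSystem M W) {x y w : W}
    (hx : inversions cs x ⊆ inversions cs w) (hy : inversions cs y ⊆ inversions cs w) :
    ∃ j, IsJoin cs x y j := by
  induction hn : cs.length w using Nat.strong_induction_on generalizing x y w with
  | _ n ih =>
  have common : ∀ {i : B} {x y : W}, inversions cs x ⊆ inversions cs w →
      inversions cs y ⊆ inversions cs w → cs.simple i ∈ inversions cs x →
      cs.simple i ∈ inversions cs y → ∃ j, IsJoin cs x y j := by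
    intro i x y hx hy hix hiy
    obtain ⟨j, hj1, hj2, hj3⟩ := ih _
      (by have := length_simple_mul_of_mem cs (hx hix); omega)
      (inversions_simple_mul_subset_simple_mul cs hx fun _ => hix)
      (inversions_simple_mul_subset_simple_mul cs hy fun _ => hiy) rfl
    have hnj : cs.simple i ∉ inversions cs j := fun h => by
      have := hj3 (cs.simple i * w)
        (inversions_simple_mul_subset_simple_mul cs hx fun _ => hix)
        (inversions_simple_mul_subset_simple_mul cs hy fun _ => hiy) h
      exact (simple_mem_inversions_simple_mul cs).1 this (hx hix)
    have hij := (simple_mem_inversions_simple_mul cs).2 hnj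
    refine ⟨cs.simple i * j, ?_, ?_, fun w' hxw hyw => ?_⟩
    · simpa using inversions_simple_mul_subset_simple_mul cs (i := i) hj1 fun h => absurd h hnj
    · simpa using inversions_simple_mul_subset_simple_mul cs (i := i) hj2 fun h => absurd h hnj
    · have := hj3 (cs.simple i * w')
        (inversions_simple_mul_subset_simple_mul cs hxw fun _ => hix)
        (inversions_simple_mul_subset_simple_mul cs hyw fun _ => hiy)
      simpa using inversions_simple_mul_subset_simple_mul cs (i := i) this
        fun h => absurd (hxw hix) ((simple_mem_inversions_simple_mul cs).1 h)
  by_cases hx1 : x = 1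
  · subst hx1
    exact ⟨y, by simp [inversions_one], subset_rfl, fun _ _ h => h⟩
  by_cases hy1 : y = 1
  · subst hy1
    exact ⟨x, subset_rfl, by simp [inversions_one], fun _ h _ => h⟩
  obtain ⟨a, ha⟩ := cs.exists_leftDescent_of_ne_one hx1
  obtain ⟨b, hb⟩ := cs.exists_leftDescent_of_ne_one hy1
  have ha : cs.simple a ∈ inversions cs x := ⟨cs.isReflection_simple a, ha⟩
  have hb : cs.simple b ∈ inversions cs y := ⟨cs.isReflection_simple b, hb⟩
  obtain ⟨δ, hδa, hδb, hδ⟩ := exists_join_simple cs (hx ha) (hy hb)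
  have hδw := hδ w (hx ha) (hy hb)
  obtain ⟨jx, hx1, hx2, hx3⟩ := common hx hδw ha hδa
  obtain ⟨jy, hy1, hy2, hy3⟩ := common hy hδw hb hδb
  obtain ⟨j, h1, h2, h3⟩ := common (hx3 w hx hδw) (hy3 w hy hδw) (hx2 hδa) (hy2 hδa)
  refine ⟨j, hx1.trans h1, hy1.trans h2, fun w' hxw hyw => ?_⟩
  have hδw' := hδ w' (hxw ha) (hyw hb)
  exact h3 w' (hx3 w' hxw hδw') (hy3 w' hyw hδw')

open Classical in
/-- The join of `x` and `y` for the weak order (`1` if there is none). -/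
noncomputable def join (cs : CoxeterSystem M W) (x y : W) : W :=
  if h : ∃ j, IsJoin cs x y j then h.choose else 1

theorem isJoin_join (cs : CoxeterSystem M W) {x y w : W}
    (hx : inversions cs x ⊆ inversions cs w) (hy : inversions cs y ⊆ inversions cs w) :
    IsJoin cs x y (join cs x y) := by
  have h := exists_isJoin cs hx hy
  rw [join, dif_pos h]
  exact h.choose_spec

/-- A half-space not containing `1` has finitely many minimal elements for the weak order. -/
theorem exists_finite_minimal_of_isReflection (cs : CoxeterSystem M W) {t : W}
    (ht : cs.IsReflection t) :
    ∃ U : Set W, U.Finite ∧ ∀ a, t ∈ inversions cs a →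
      ∃ u ∈ U, inversions cs u ⊆ inversions cs a ∧ t ∈ inversions cs u := by
  obtain ⟨w, i, rfl⟩ := ht
  induction w using cs.simple_induction_left with
  | one =>
    refine ⟨{cs.simple i}, Set.finite_singleton _, fun a ha => ⟨_, rfl, ?_, ?_⟩⟩
    · intro r hr
      rw [mem_inversions_simple] at hr
      simpa [hr] using ha
    · simp [mem_inversions_simple]
  | mul_simple_left w k ih =>
    obtain ⟨U, hU, h⟩ := ih
    set t := w * cs.simple i * w⁻¹ with ht
    have htk : cs.simple k * w * cs.simple i * (cs.simple k * w)⁻¹ =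
        cs.simple k * t * cs.simple k := by simp [ht, mul_assoc]
    rw [htk]
    by_cases hts : t = cs.simple k
    · refine ⟨{cs.simple k}, Set.finite_singleton _, fun a ha => ⟨_, rfl, ?_, ?_⟩⟩
      · intro r hr
        rw [mem_inversions_simple] at hr
        simpa [hr, hts] using ha
      · simp [mem_inversions_simple, hts]
    have hts' : cs.simple k * t * cs.simple k ≠ cs.simple k := fun h => hts <| by
      simpa [mul_assoc] using congrArg (fun g => cs.simple k * g * cs.simple k) h
    refine ⟨(fun u => cs.simple k * u) '' U ∪
      (fun u => cs.simple k * join cs (cs.simple k) u) '' U,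
      (hU.image _).union (hU.image _), fun a ha => ?_⟩
    have hconj : ∀ b, cs.simple k * t * cs.simple k ∈ inversions cs (cs.simple k * b) ↔
        t ∈ inversions cs b := by
      intro b
      rw [mem_inversions_simple_mul, iff_false_left hts', not_not]
      simp [mul_assoc]
    have ha' : t ∈ inversions cs (cs.simple k * a) := by
      rw [← hconj]; simpa using ha
    obtain ⟨u, huU, hu, htu⟩ := h _ ha'
    by_cases hka : cs.simple k ∈ inversions cs a
    · refine ⟨cs.simple k * u, Or.inl ⟨u, huU, rfl⟩, ?_, (hconj u).2 htu⟩
      simpa using inversions_simple_mul_subset_simple_mul cs (i := k) hu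
        fun h => absurd hka ((simple_mem_inversions_simple_mul cs).1 h)
    · have hs : inversions cs (cs.simple k) ⊆ inversions cs (cs.simple k * a) := by
        intro r hr
        rw [mem_inversions_simple] at hr
        rw [hr]
        exact (simple_mem_inversions_simple_mul cs).2 hka
      obtain ⟨h1, h2, h3⟩ := isJoin_join cs hs hu
      refine ⟨_, Or.inr ⟨u, huU, rfl⟩, ?_, (hconj _).2 (h2 htu)⟩
      simpa using inversions_simple_mul_subset_simple_mul cs (i := k) (h3 _ hs hu)
        fun _ => h1 ((mem_inversions_simple cs).2 rfl)

/-- For a finite set `F` of reflections, finitely many elements suffice to dominate the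
`F`-inversions of every `a` from below `a` in the weak order. -/
theorem exists_finite_dominating (cs : CoxeterSystem M W) {F : Set W} (hF : F.Finite) :
    ∃ U : Set W, U.Finite ∧ ∀ a, ∃ u ∈ U, inversions cs u ⊆ inversions cs a ∧
      inversions cs a ∩ F ⊆ inversions cs u := by
  induction F, hF using Set.Finite.induction_on with
  | empty => exact ⟨{1}, Set.finite_singleton _, fun a => ⟨1, rfl, by simp [inversions_one]⟩⟩
  | @insert t F _ _ ih =>
    obtain ⟨U, hU, h⟩ := ih
    by_cases ht : cs.IsReflection t
    · obtain ⟨V, hV, h'⟩ := exists_finite_minimal_of_isReflection cs ht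
      refine ⟨U ∪ Set.image2 (join cs) U V, hU.union (hU.image2 _ hV), fun a => ?_⟩
      obtain ⟨u, huU, hu, huF⟩ := h a
      by_cases hta : t ∈ inversions cs a
      · obtain ⟨v, hvV, hv, htv⟩ := h' a hta
        obtain ⟨h1, h2, h3⟩ := isJoin_join cs hu hv
        refine ⟨_, Or.inr ⟨u, huU, v, hvV, rfl⟩, h3 a hu hv, ?_⟩
        rintro r ⟨hr, rfl | hrF⟩
        · exact h2 htv
        · exact h1 (huF ⟨hr, hrF⟩)
      · refine ⟨u, Or.inl huU, hu, ?_⟩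
        rintro r ⟨hr, rfl | hrF⟩
        · exact absurd hr hta
        · exact huF ⟨hr, hrF⟩
    · refine ⟨U, hU, fun a => ?_⟩
      obtain ⟨u, huU, hu, huF⟩ := h a
      refine ⟨u, huU, hu, ?_⟩
      rintro r ⟨hr, rfl | hrF⟩
      · exact absurd hr.1 ht
      · exact huF ⟨hr, hrF⟩

/-- Every nonempty family has a meet for the weak order. -/
theorem exists_meet (cs : CoxeterSystem M W) {V : Set W} (hV : V.Nonempty) :
    ∃ m, (∀ v ∈ V, inversions cs m ⊆ inversions cs v) ∧
      ∀ u, (∀ v ∈ V, inversions cs u ⊆ inversions cs v) → inversions cs u ⊆ inversions cs m := by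
  obtain ⟨v₀, hv₀⟩ := hV
  set L : Set ℕ := {n | ∃ u, (∀ v ∈ V, inversions cs u ⊆ inversions cs v) ∧ cs.length u = n}
  have hbdd : BddAbove L := ⟨cs.length v₀, by rintro _ ⟨u, hu, rfl⟩; exact length_mono cs (hu _ hv₀)⟩
  have hne : L.Nonempty := ⟨_, 1, by simp [inversions_one], rfl⟩
  obtain ⟨m, hm, hlen⟩ := Nat.sSup_mem hne hbdd
  refine ⟨m, hm, fun u hu => ?_⟩
  obtain ⟨h1, h2, h3⟩ := isJoin_join cs (hm _ hv₀) (hu _ hv₀)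
  have hle : cs.length (join cs m u) ≤ sSup L :=
    le_csSup hbdd ⟨_, fun v hv => h3 v (hm v hv) (hu v hv), rfl⟩
  rw [eq_of_inversions_subset cs h1 (by omega)]
  exact h2

theorem exists_simple_mul_subset (cs : CoxeterSystem M W) {u w : W}
    (h : inversions cs u ⊆ inversions cs w) (hl : cs.length u < cs.length w) :
    ∃ i, inversions cs u ⊆ inversions cs (u * cs.simple i) ∧
      inversions cs (u * cs.simple i) ⊆ inversions cs w ∧
      cs.length (u * cs.simple i) = cs.length u + 1 := by
  have h1 := length_add_length_inv_mul cs h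
  have hne : u⁻¹ * w ≠ 1 := fun h0 => by rw [h0, cs.length_one] at h1; omega
  obtain ⟨i, hi⟩ := cs.exists_leftDescent_of_ne_one hne
  rw [cs.isLeftDescent_iff] at hi
  have h2 := cs.length_mul_le (u * cs.simple i) (cs.simple i * (u⁻¹ * w))
  rw [show u * cs.simple i * (cs.simple i * (u⁻¹ * w)) = w by simp [mul_assoc]] at h2
  have h3 : cs.length (u * cs.simple i) = cs.length u + 1 := by
    rcases cs.length_mul_simple u i with h' | h' <;> omega
  refine ⟨i, inversions_subset_of_length_add_le cs ?_, inversions_subset_of_length_add_le cs ?_, h3⟩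
  · simp [h3]
  · rw [mul_inv_rev, CoxeterSystem.inv_simple, mul_assoc]
    omega

/-- An unbounded chain of the weak order lies on a geodesic edge path ray. -/
theorem exists_isGeodesicRay_of_chain (cs : CoxeterSystem M W) {w : ℕ → W}
    (hmono : ∀ k, inversions cs (w k) ⊆ inversions cs (w (k + 1)))
    (hunb : ∀ n, ∃ k, n ≤ cs.length (w k)) :
    ∃ b : ℕ → W, IsGeodesicRay cs b ∧ ∀ k, ∃ n, b n = w k := by
  classical
  have hm : Monotone fun k => inversions cs (w k) := monotone_nat_of_le_succ hmono
  set P : ℕ → W → Prop := fun n u => cs.length u = n ∧ ∀ k,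
    (cs.length (w k) ≤ n → inversions cs (w k) ⊆ inversions cs u) ∧
    (n ≤ cs.length (w k) → inversions cs u ⊆ inversions cs (w k)) with hP
  have step : ∀ n u, P n u → ∃ u', Adj cs u u' ∧ P (n + 1) u' ∧
      inversions cs u ⊆ inversions cs u' := by
    intro n u ⟨hu, hk⟩
    have hex := hunb (n + 1)
    set K := Nat.find hex with hK
    have hKs : n + 1 ≤ cs.length (w K) := Nat.find_spec hex
    obtain ⟨i, h1, h2, h3⟩ := exists_simple_mul_subset cs ((hk K).2 (by omega)) (by omega)
    refine ⟨_, ⟨i, rfl⟩, ⟨by omega, fun k => ⟨fun hle => ?_, fun hle => ?_⟩⟩, h1⟩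
    · rcases Nat.lt_or_ge n (cs.length (w k)) with hlt | hge
      · have := h2.trans (hm (Nat.find_min' hex hlt))
        rw [eq_of_inversions_subset cs this (by omega)]
      · exact ((hk k).1 hge).trans h1
    · exact h2.trans (hm (Nat.find_min' hex hle))
  have hP0 : P 0 1 := by
    refine ⟨cs.length_one, fun k => ⟨fun h => ?_, fun _ => by simp [inversions_one]⟩⟩
    rw [cs.length_eq_zero_iff.1 (Nat.le_zero.1 h)]
  choose! nxt hadj hnxt hsub using step
  set b : ℕ → W := fun n => Nat.rec 1 (fun n u => nxt n u) n
  have hbP : ∀ n, P n (b n) := by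
    intro n
    induction n with
    | zero => exact hP0
    | succ n ih => exact hnxt n _ ih
  have hbm : Monotone fun n => inversions cs (b n) :=
    monotone_nat_of_le_succ fun n => hsub n _ (hbP n)
  refine ⟨b, ⟨fun n => hadj n _ (hbP n), fun j k hjk => ?_⟩, fun k => ⟨cs.length (w k), ?_⟩⟩
  · have := length_add_length_inv_mul cs (hbm hjk)
    have h1 := (hbP j).1
    have h2 := (hbP k).1
    rw [d]
    omega
  · exact eq_of_inversions_subset cs (((hbP _).2 k).2 le_rfl) (hbP _).1.ge

end WeakOrder

section Convexity

/-- A discretely convex sequence is bounded on an interval by its values at the endpoints. -/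
theorem le_max_of_discrete_convex {f : ℕ → ℝ} (hf : ∀ n, 2 * f (n + 1) ≤ f n + f (n + 2))
    {i k j : ℕ} (hik : i ≤ k) (hkj : k ≤ j) : f k ≤ max (f i) (f j) := by
  have hg : Monotone fun n => f (n + 1) - f n :=
    monotone_nat_of_le_succ fun n => by have := hf n; linarith
  by_contra! h
  obtain ⟨hi, hj⟩ := max_lt_iff.1 h
  obtain ⟨n, hn, hpos⟩ : ∃ n < k, f n < f (n + 1) := by
    by_contra! hall
    have : ∀ m, i ≤ m → m ≤ k → f m ≤ f i := fun m hm => by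
      induction m, hm using Nat.le_induction with
      | base => simp
      | succ m _ ih => exact fun hmk => (hall m (by omega)).trans (ih (by omega))
    linarith [this k hik le_rfl]
  have : f k ≤ f j := by
    induction j, hkj using Nat.le_induction with
    | base => exact le_rfl
    | succ m hm ih =>
      have h1 := hg (show n ≤ m by omega)
      have h2 : f m ≤ f (m + 1) := by simp only at h1; linarith
      by_cases hmk : f m < f k
      · exact (ih (max_lt hi hmk) hmk).trans h2
      · linarith
  linarith

variable {X : Type*} [MetricSpace X]

/-- In a CAT(0) space, midpoints of two sides of a triangle are at most half as far apart as
the endpoints of the third side. -/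
theorem IsCAT0.dist_midpoints_le (hX : IsCAT0 X) {p q q' m m' : X}
    (h1 : dist p m = dist p q / 2) (h2 : dist m q = dist p q / 2)
    (h1' : dist p m' = dist p q' / 2) (h2' : dist m' q' = dist p q' / 2) :
    dist m m' ≤ dist q q' / 2 := by
  have a := hX.2 m p q' m' h1' h2'
  have b := hX.2 q' p q m h1 h2
  rw [dist_comm m p, h1, dist_comm m q'] at a
  rw [dist_comm q' p, dist_comm q' q] at b
  exact abs_le_of_sq_le_sq' (by nlinarith) (by positivity) |>.2

theorem IsCAT0.dist_midpoints_le_add (hX : IsCAT0 X) {p q p' q' m m' : X}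
    (h1 : dist p m = dist p q / 2) (h2 : dist m q = dist p q / 2)
    (h1' : dist p' m' = dist p' q' / 2) (h2' : dist m' q' = dist p' q' / 2) :
    2 * dist m m' ≤ dist p p' + dist q q' := by
  obtain ⟨c, hc1, hc2⟩ := hX.1 p q'
  have a := hX.dist_midpoints_le h1 h2 hc1 hc2
  have b := hX.dist_midpoints_le (p := q') (q := p) (q' := p') (m := c) (m' := m')
    (by rw [dist_comm, hc2, dist_comm p]) (by rw [dist_comm, hc1, dist_comm p])
    (by rw [dist_comm, h2', dist_comm p']) (by rw [dist_comm, h1', dist_comm p'])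
  linarith [dist_triangle m c m']

/-- In a CAT(0) space, the displacement of an isometry along a geodesic ray is bounded on an
interval by its values at the endpoints. -/
theorem IsCAT0.dist_isometry_le_max (hX : IsCAT0 X) {γ : ℝ → X}
    (hγ : ∀ s u : ℝ, 0 ≤ s → 0 ≤ u → dist (γ s) (γ u) = |s - u|) {g : X → X} (hg : Isometry g)
    {i k j : ℕ} (hik : i ≤ k) (hkj : k ≤ j) :
    dist (γ k) (g (γ k)) ≤ max (dist (γ i) (g (γ i))) (dist (γ j) (g (γ j))) := by
  refine le_max_of_discrete_convex (f := fun n : ℕ => dist (γ n) (g (γ n))) (fun n => ?_) hik hkj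
  have e1 : dist (γ n) (γ (n + 1 : ℕ)) = dist (γ n) (γ (n + 2 : ℕ)) / 2 := by
    rw [hγ _ _ (by positivity) (by positivity), hγ _ _ (by positivity) (by positivity)]
    push_cast
    norm_num
  have e2 : dist (γ (n + 1 : ℕ)) (γ (n + 2 : ℕ)) = dist (γ n) (γ (n + 2 : ℕ)) / 2 := by
    rw [hγ _ _ (by positivity) (by positivity), hγ _ _ (by positivity) (by positivity)]
    push_cast
    norm_num
  exact hX.dist_midpoints_le_add e1 e2 (by simpa only [hg.dist_eq] using e1)
    (by simpa only [hg.dist_eq] using e2)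

end Convexity

section Tracking

variable {X : Type*} [MetricSpace X] [MulAction W X]

theorem finite_dist_smul_le [ProperSpace X]
    (hpd : ∀ C : Set X, IsCompact C → {w : W | (w • C) ∩ C ≠ ∅}.Finite) (x : X) (R : ℝ) :
    {w : W | dist x (w • x) ≤ R}.Finite := by
  refine (hpd _ (isCompact_closedBall x R)).subset fun w hw => ?_
  have hR : 0 ≤ R := dist_nonneg.trans hw
  refine Set.Nonempty.ne_empty ⟨w • x, Set.smul_mem_smul_set (Metric.mem_closedBall_self hR), ?_⟩
  rwa [Metric.mem_closedBall, dist_comm]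

theorem exists_dist_smul_le_mul_length [Finite B] (cs : CoxeterSystem M W)
    (hiso : ∀ w : W, Isometry (fun y : X => w • y)) (x : X) :
    ∃ A : ℝ, 0 ≤ A ∧ ∀ w : W, dist x (w • x) ≤ A * cs.length w := by
  obtain ⟨A, hA⟩ := (Set.finite_range fun i => dist x (cs.simple i • x)).bddAbove
  have hA' : ∀ i, dist x (cs.simple i • x) ≤ max A 0 :=
    fun i => (hA ⟨i, rfl⟩).trans (le_max_left _ _)
  refine ⟨max A 0, le_max_right _ _, fun w => ?_⟩
  obtain ⟨ω, hω, rfl⟩ := cs.exists_isReduced w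
  rw [hω.eq]
  clear hω
  induction ω with
  | nil => simp
  | cons i ω ih =>
    have h1 := dist_triangle x (cs.simple i • x) (cs.simple i • cs.wordProd ω • x)
    rw [(hiso (cs.simple i)).dist_eq] at h1
    rw [cs.wordProd_cons, mul_smul, List.length_cons]
    push_cast
    linarith [hA' i]

theorem dist_smul_conj (hiso : ∀ w : W, Isometry (fun y : X => w • y)) (v t : W) (x : X) :
    dist x ((v⁻¹ * t * v) • x) = dist (v • x) (t • v • x) := by
  rw [← (hiso v).dist_eq x]
  simp only [← mul_smul, ← mul_assoc, mul_inv_cancel, one_mul]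

theorem dist_smul_self_le (hiso : ∀ w : W, Isometry (fun y : X => w • y)) (t : W) {y z : X}
    {D : ℝ} (h : dist y z ≤ D) : dist y (t • y) ≤ dist z (t • z) + 2 * D := by
  have h1 := dist_triangle4 y z (t • z) (t • y)
  rw [(hiso t).dist_eq, dist_comm z y] at h1
  linarith

/-- The walls that an orbit approximation `v` of a CAT(0) geodesic ray crosses back and forth,
before and after `v k`, are uniformly close to `v k`. -/
theorem exists_finite_brackets [ProperSpace X] (cs : CoxeterSystem M W) (hX : IsCAT0 X)
    (hiso : ∀ w : W, Isometry (fun y : X => w • y))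
    (hpd : ∀ C : Set X, IsCompact C → {w : W | (w • C) ∩ C ≠ ∅}.Finite) (x : X) (D : ℝ) :
    ∃ F : Set W, F.Finite ∧ ∀ (γ : ℝ → X) (v : ℕ → W),
      (∀ s u : ℝ, 0 ≤ s → 0 ≤ u → dist (γ s) (γ u) = |s - u|) →
      (∀ k : ℕ, dist (γ k) (v k • x) ≤ D) → v 0 = 1 →
      ∀ k j, k ≤ j → ∀ t, t ∈ inversions cs (v k) → t ∉ inversions cs (v j) →
        (v k)⁻¹ * t * v k ∈ F := by
  set F₀ : Set W := ⋃ g ∈ {w : W | dist x (w • x) ≤ 2 * D + 1}, inversions cs g with hF₀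
  have hF₀fin : F₀.Finite :=
    (finite_dist_smul_le hpd x _).biUnion fun g _ => finite_inversions cs g
  obtain ⟨C, hC⟩ := (hF₀fin.image fun f => dist x (f • x)).bddAbove
  refine ⟨_, finite_dist_smul_le hpd x (C + 4 * D), fun γ v hγ hv hv0 k j hkj t htk htj => ?_⟩
  have crossing : ∀ i, (t ∈ inversions cs (v i) ↔ t ∉ inversions cs (v (i + 1))) →
      dist (γ i) (t • γ i) ≤ C + 2 * D := by
    intro i hi
    have hmul := mem_inversions_mul cs (a := v i) (b := (v i)⁻¹ * v (i + 1)) (t := t)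
    rw [mul_inv_cancel_left] at hmul
    have hmem : (v i)⁻¹ * t * v i ∈ F₀ := by
      refine Set.mem_biUnion (x := (v i)⁻¹ * v (i + 1)) ?_ (by tauto)
      have h1 := dist_triangle4 (v i • x) (γ i) (γ (i + 1 : ℕ)) (v (i + 1) • x)
      have h2 : dist (γ i) (γ (i + 1 : ℕ)) = 1 := by
        rw [hγ _ _ (by positivity) (by positivity)]
        push_cast
        norm_num
      have h3 : dist x (((v i)⁻¹ * v (i + 1)) • x) = dist (v i • x) (v (i + 1) • x) := by
        rw [← (hiso (v i)).dist_eq x]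
        simp only [← mul_smul, mul_inv_cancel_left]
      rw [Set.mem_ofPred_eq, h3]
      have h4 := hv i
      have h5 := hv (i + 1)
      rw [dist_comm] at h4
      linarith
    have h1 := hC ⟨_, hmem, rfl⟩
    simp only [dist_smul_conj hiso] at h1
    linarith [dist_smul_self_le hiso t (hv i)]
  obtain ⟨i, hik, hi⟩ : ∃ i < k, (t ∈ inversions cs (v i) ↔ t ∉ inversions cs (v (i + 1))) := by
    by_contra! hno
    have : ∀ i ≤ k, t ∉ inversions cs (v i) := by
      intro i
      induction i with
      | zero => simp [hv0, inversions_one]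
      | succ i ih => intro hi; have := ih (by omega); have := hno i (by omega); tauto
    exact this k le_rfl htk
  obtain ⟨m, hkm, hm⟩ : ∃ m, k ≤ m ∧
      (t ∈ inversions cs (v m) ↔ t ∉ inversions cs (v (m + 1))) := by
    by_contra! hno
    have : ∀ m, k ≤ m → t ∈ inversions cs (v m) := by
      intro m hm
      induction m, hm using Nat.le_induction with
      | base => exact htk
      | succ m hm ih => have := hno m hm; tauto
    exact htj (this j hkj)
  have hdist := hX.dist_isometry_le_max hγ (hiso t) hik.le hkm
  have hk : dist (γ k) (t • γ k) ≤ C + 2 * D := hdist.trans (max_le (crossing i hi) (crossing m hm))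
  rw [Set.mem_ofPred_eq, dist_smul_conj hiso]
  have h1 := hv k
  rw [dist_comm] at h1
  linarith [dist_smul_self_le hiso t h1]

/-- If the walls crossed back and forth by `v` around `v k` lie in a fixed finite set of
translates, then `v` stays uniformly close to a chain of the weak order. -/
theorem exists_chain_near (cs : CoxeterSystem M W) {F : Set W} (hF : F.Finite) :
    ∃ L : ℕ, ∀ v : ℕ → W,
      (∀ k j, k ≤ j → ∀ t, t ∈ inversions cs (v k) → t ∉ inversions cs (v j) →
        (v k)⁻¹ * t * v k ∈ F) →
      ∃ w : ℕ → W, (∀ k, inversions cs (w k) ⊆ inversions cs (w (k + 1))) ∧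
        ∀ k, cs.length ((w k)⁻¹ * v k) ≤ L ∧ cs.length (v k) ≤ cs.length (w k) + L := by
  obtain ⟨U, hU, hdom⟩ := exists_finite_dominating cs hF
  obtain ⟨L, hL⟩ := (hU.image cs.length).bddAbove
  refine ⟨L, fun v hv => ?_⟩
  choose w hw hmax using fun k => exists_meet cs (V := v '' Set.Ici k) ⟨_, k, Set.self_mem_Ici, rfl⟩
  have hwv : ∀ k j, k ≤ j → inversions cs (w k) ⊆ inversions cs (v j) :=
    fun k j hkj => hw k _ ⟨j, hkj, rfl⟩
  have hlen : ∀ k, cs.length (v k) ≤ cs.length (w k) + L := by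
    intro k
    obtain ⟨u, huU, hu, huF⟩ := hdom (v k)⁻¹
    have hinv : ∀ t, t ∈ inversions cs (v k) ↔ (v k)⁻¹ * t * v k ∈ inversions cs (v k)⁻¹ := by
      intro t
      have := mem_inversions_mul cs (a := v k) (b := (v k)⁻¹) (t := t)
      rw [mul_inv_cancel, inversions_one] at this
      simpa using this
    have hvu : inversions cs (v k * u) ⊆ inversions cs (w k) := by
      refine hmax k _ ?_
      rintro _ ⟨j, hkj, rfl⟩ t ht
      rw [mem_inversions_mul] at ht
      have h1 := hinv t
      have h2 := @hu ((v k)⁻¹ * t * v k)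
      have h3 : ¬((v k)⁻¹ * t * v k ∈ F ∧ (v k)⁻¹ * t * v k ∈ inversions cs (v k)⁻¹) ∨
          (v k)⁻¹ * t * v k ∈ inversions cs u := by
        rw [or_iff_not_imp_left, not_not]
        exact fun h => huF ⟨h.2, h.1⟩
      have h4 := hv k j hkj t
      tauto
    have h1 := length_mono cs hvu
    have h2 : cs.length u ≤ L := hL ⟨u, huU, rfl⟩
    have h3 := cs.length_le_length_mul_add_right (v k) u
    omega
  refine ⟨w, fun k => hmax (k + 1) _ ?_, fun k => ⟨?_, hlen k⟩⟩
  · rintro _ ⟨j, hj, rfl⟩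
    exact hwv k j (Nat.le_of_succ_le hj)
  · have := length_add_length_inv_mul cs (hwv k k le_rfl)
    have := hlen k
    omega

end Tracking

/-- Suppose the Coxeter group `W` of the system `(W,S)` acts geometrically (properly
discontinuously, cocompactly, and by isometries) on a proper CAT(0) space `X`, and
`x ∈ X` is fixed by no nontrivial element of `W`. Then there is a constant `K` such that
every CAT(0) geodesic ray in `X` issuing from `x` is `K`-tracked by the image under `P_x`
of a geodesic edge path ray of the Cayley graph `Λ(W,S)`: every point of the ray is within
`K` of a point of `P_x(β)`, i.e. of a point lying on an edge of `Λ_x` joining consecutive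
vertices `β k • x` and `β (k+1) • x`. -/
theorem cat0_geodesics_tracked {B : Type*} {W : Type*} [Group W] [Finite B]
    {M : CoxeterMatrix B} (cs : CoxeterSystem M W)
    (X : Type*) [MetricSpace X] [ProperSpace X] (hX : IsCAT0 X)
    [MulAction W X]
    (hiso : ∀ w : W, Isometry (fun y : X => w • y))
    (hpd : ∀ C : Set X, IsCompact C → {w : W | (w • C) ∩ C ≠ ∅}.Finite)
    (hcc : ∃ C : Set X, IsCompact C ∧ ⋃ w : W, w • C = Set.univ)
    (x : X) (hx : ∀ w : W, w • x = x → w = 1) :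
    ∃ K : ℝ, ∀ γ : ℝ → X, γ 0 = x →
      (∀ s u : ℝ, 0 ≤ s → 0 ≤ u → dist (γ s) (γ u) = |s - u|) →
      ∃ b : ℕ → W, IsGeodesicRay cs b ∧
        ∀ s : ℝ, 0 ≤ s → ∃ (k : ℕ) (z : X),
          dist (b k • x) z + dist z (b (k+1) • x) = dist (b k • x) (b (k+1) • x) ∧
          dist (γ s) z ≤ K := by
  obtain ⟨C, hC, hcover⟩ := hcc
  have hmemC : ∀ y : X, ∃ w : W, ∃ c ∈ C, w • c = y := by
    intro y
    have hy : y ∈ ⋃ w : W, w • C := hcover ▸ Set.mem_univ y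
    obtain ⟨w, hw⟩ := Set.mem_iUnion.1 hy
    exact ⟨w, Set.mem_smul_set.1 hw⟩
  obtain ⟨D, hD⟩ := (hC.isBounded.subset_closedBall x)
  have hnear : ∀ y : X, ∃ w : W, dist y (w • x) ≤ D := by
    intro y
    obtain ⟨w, c, hc, rfl⟩ := hmemC y
    exact ⟨w, by rw [(hiso w).dist_eq]; exact hD hc⟩
  have hD0 : 0 ≤ D := by
    obtain ⟨w, hw⟩ := hnear x
    exact dist_nonneg.trans hw
  obtain ⟨F, hF, hbr⟩ := exists_finite_brackets cs hX hiso hpd x D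
  obtain ⟨L, hL⟩ := exists_chain_near cs hF
  obtain ⟨A, hA0, hA⟩ := exists_dist_smul_le_mul_length cs hiso x
  refine ⟨1 + D + A * L, fun γ hγ0 hγ => ?_⟩
  obtain ⟨v, hv, hv0⟩ : ∃ v : ℕ → W, (∀ k : ℕ, dist (γ k) (v k • x) ≤ D) ∧ v 0 = 1 := by
    choose v hv using fun k : ℕ => hnear (γ k)
    refine ⟨fun k => if k = 0 then 1 else v k, fun k => ?_, if_pos rfl⟩
    rcases eq_or_ne k 0 with rfl | hk
    · simpa [hγ0] using hD0
    · simpa [hk] using hv k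
  obtain ⟨w, hmono, hw⟩ := hL v (hbr γ v hγ hv hv0)
  have hunb : ∀ n, ∃ k, n ≤ cs.length (w k) := by
    intro n
    obtain ⟨k, hk⟩ := exists_nat_gt (A * (n + L) + D)
    refine ⟨k, ?_⟩
    by_contra! hlt
    have h1 : (cs.length (v k) : ℝ) ≤ n + L := by
      have := (hw k).2
      exact_mod_cast (by omega : cs.length (v k) ≤ n + L)
    have h2 := dist_triangle x (v k • x) (γ k)
    have h3 : dist x (γ k) = k := by
      rw [← hγ0, hγ _ _ le_rfl (by positivity)]
      simp
    have h4 := hv k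
    rw [dist_comm] at h4
    have h5 := hA (v k)
    have h6 := mul_le_mul_of_nonneg_left h1 hA0
    linarith
  obtain ⟨b, hb, hbw⟩ := exists_isGeodesicRay_of_chain cs hmono hunb
  refine ⟨b, hb, fun s hs => ?_⟩
  obtain ⟨n, hn⟩ := hbw ⌊s⌋₊
  refine ⟨n, b n • x, by simp, ?_⟩
  rw [hn]
  set k := ⌊s⌋₊
  have h1 : dist (γ s) (γ k) ≤ 1 := by
    rw [hγ _ _ hs (by positivity), abs_le]
    have := Nat.floor_le hs
    have := Nat.lt_floor_add_one s
    constructor <;> linarith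
  have h2 := dist_triangle4 (γ s) (γ k) (v k • x) (w k • x)
  have h3 : dist (v k • x) (w k • x) ≤ A * L := by
    have h4 : dist (w k • x) (v k • x) = dist x (((w k)⁻¹ * v k) • x) := by
      rw [← (hiso (w k)).dist_eq x]
      simp only [← mul_smul, mul_inv_cancel_left]
    rw [dist_comm, h4]
    refine (hA _).trans (mul_le_mul_of_nonneg_left ?_ hA0)
    exact_mod_cast (hw k).1
  linarith [hv k]

end CoxTrack
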